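/- (Spectral properties of small eigenvalue eigenvectors.) Let T and U be finite sets, B a complex matrix with rows indexed by T and columns by U, and |t⟩ ∈ ℂ^T. Suppose there exist vectors ψ_T ∈ ℂ^T and ψ_U ∈ ℂ^U, not both zero, with B ψ_U = 0, B* ψ_T = 0, and |⟨t|ψ_T⟩|² ≥ δ(‖ψ_T‖² + ‖ψ_U‖²) for some δ > 0. Let A' be the Hermitian matrix indexed by T ⊔ {μ₀} ⊔ U given in block form by A' = [[0, |t⟩, B],[⟨t|, 0, 0],[B*, 0, 0]], let {|α⟩} be an orthonormal eigenbasis of A' with eigenvalues ρ(α), and let |0⟩ be the standard basis vector at index μ₀. Then for every γ > 0, Σ_{α : |ρ(α)| ≤ γ} |⟨α|0⟩|² ≤ 8γ²/δ. -/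

import Mathlib

open scoped Matrix Classical

/-- The Hermitian adjacency matrix `A' = [[0, |t⟩, B], [⟨t|, 0, 0], [B*, 0, 0]]`
indexed by `T ⊔ {μ₀} ⊔ U`, obtained from a bipartite graph with biadjacency
matrix `B` by adjoining an extra vertex `μ₀` joined to `T` with weights `t`. -/
def adjExt {T U : Type*} (B : Matrix T U ℂ) (t : T → ℂ) :
    Matrix (T ⊕ Unit ⊕ U) (T ⊕ Unit ⊕ U) ℂ :=
  Matrix.of fun p q =>
    match p, q with
    | Sum.inl i, Sum.inr (Sum.inl _) => t i
    | Sum.inl i, Sum.inr (Sum.inr u) => B i u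
    | Sum.inr (Sum.inl _), Sum.inl i => star (t i)
    | Sum.inr (Sum.inr u), Sum.inl i => star (B i u)
    | _, _ => 0

/-- Bessel's inequality for a family of coordinate vectors orthonormal for the dot product. -/
lemma sum_norm_sq_star_dotProduct_le {ι κ : Type*} [Fintype ι]
    (α : κ → ι → ℂ) (horth : ∀ a b, star (α a) ⬝ᵥ α b = if a = b then 1 else 0)
    (s : Finset κ) (x : ι → ℂ) :
    ∑ a ∈ s, ‖star (α a) ⬝ᵥ x‖ ^ 2 ≤ ∑ i, ‖x i‖ ^ 2 := by
  have hv : Orthonormal ℂ fun a => WithLp.toLp 2 (α a) := by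
    rw [orthonormal_iff_ite]
    intro a b
    rw [EuclideanSpace.inner_toLp_toLp, dotProduct_comm, horth]
  have h := hv.sum_inner_products_le (WithLp.toLp 2 x) (s := s)
  rw [EuclideanSpace.norm_sq_eq] at h
  simpa only [EuclideanSpace.inner_toLp_toLp, dotProduct_comm x] using h

lemma adjExt_isHermitian {T U : Type*} (B : Matrix T U ℂ) (t : T → ℂ) :
    (adjExt B t).IsHermitian := by
  ext p q
  rcases p with p | p | p <;> rcases q with q | q | q <;> simp [adjExt]

/-- A vector supported on `T` in the kernel of `Bᴴ` is mapped by `adjExt B t` to a multiple of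
the basis vector at the extra vertex. -/
lemma adjExt_mulVec_elim {T U : Type*} [Fintype T] [Fintype U]
    [DecidableEq T] [DecidableEq U]
    (B : Matrix T U ℂ) (t ψ : T → ℂ) (hB : Bᴴ *ᵥ ψ = 0) :
    adjExt B t *ᵥ Sum.elim ψ 0 = Pi.single (Sum.inr (Sum.inl ())) (star t ⬝ᵥ ψ) := by
  ext p
  rcases p with p | p | p
  · simp [Matrix.mulVec, dotProduct, adjExt]
  · simp [Matrix.mulVec, dotProduct, adjExt]
  · simpa [Matrix.mulVec, dotProduct, adjExt] using congrFun hB p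

/-- **Spectral properties of small eigenvalue eigenvectors.** If `ψ_T, ψ_U` are
not both zero, `B ψ_U = 0`, `B* ψ_T = 0` and `|⟨t|ψ_T⟩|² ≥ δ(‖ψ_T‖² + ‖ψ_U‖²)`,
and `α` is an orthonormal eigenbasis of `A' = adjExt B t` with eigenvalues `ρ`,
then for every `γ > 0` the squared overlap of `|0⟩ = e_{μ₀}` with the
eigenvectors of eigenvalue at most `γ` in absolute value is at most `8γ²/δ`. -/
theorem small_eigenvalue_overlap_bound
    {T U : Type*} [Fintype T] [Fintype U] [DecidableEq T] [DecidableEq U]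
    (B : Matrix T U ℂ) (t : T → ℂ)
    (ψT : T → ℂ) (ψU : U → ℂ) (hne : ¬(ψT = 0 ∧ ψU = 0))
    (hBU : B *ᵥ ψU = 0) (hBT : Bᴴ *ᵥ ψT = 0)
    (δ : ℝ) (hδ : 0 < δ)
    (hover : δ * ((∑ i, ‖ψT i‖ ^ 2) + ∑ u, ‖ψU u‖ ^ 2) ≤ ‖star t ⬝ᵥ ψT‖ ^ 2)
    (α : (T ⊕ Unit ⊕ U) → ((T ⊕ Unit ⊕ U) → ℂ)) (ρ : (T ⊕ Unit ⊕ U) → ℝ)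
    (horth : ∀ a b, star (α a) ⬝ᵥ α b = if a = b then 1 else 0)
    (heig : ∀ a, adjExt B t *ᵥ α a = (ρ a : ℂ) • α a)
    (γ : ℝ) (hγ : 0 < γ) :
    ∑ a ∈ Finset.univ.filter (fun a => |ρ a| ≤ γ),
        ‖α a (Sum.inr (Sum.inl ()))‖ ^ 2 ≤ 8 * γ ^ 2 / δ := by
  set c := star t ⬝ᵥ ψT
  set S := ∑ i, ‖ψT i‖ ^ 2
  set R := ∑ u, ‖ψU u‖ ^ 2
  have hS : 0 ≤ S := by positivity
  have hR : 0 ≤ R := by positivity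
  have hpos : 0 < S + R := by
    refine lt_of_le_of_ne (by positivity) fun h => hne ⟨?_, ?_⟩
    · have h0 : S = 0 := by linarith
      ext i
      simpa using (Finset.sum_eq_zero_iff_of_nonneg fun _ _ => by positivity).1 h0 i
    · have h0 : R = 0 := by linarith
      ext u
      simpa using (Finset.sum_eq_zero_iff_of_nonneg fun _ _ => by positivity).1 h0 u
  have hc : 0 < ‖c‖ ^ 2 := lt_of_lt_of_le (mul_pos hδ hpos) hover
  have hcomp : ∀ a, ‖c‖ ^ 2 * ‖α a (Sum.inr (Sum.inl ()))‖ ^ 2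
      = ρ a ^ 2 * ‖star (α a) ⬝ᵥ Sum.elim ψT 0‖ ^ 2 := by
    intro a
    have h : star (α a) ⬝ᵥ (adjExt B t *ᵥ Sum.elim ψT 0)
        = ρ a * (star (α a) ⬝ᵥ Sum.elim ψT 0) := by
      have hstar := Matrix.star_mulVec (adjExt B t) (α a)
      rw [heig, (adjExt_isHermitian B t).eq] at hstar
      rw [Matrix.dotProduct_mulVec, ← hstar]
      simp
    rw [adjExt_mulVec_elim B t ψT hBT, dotProduct_single] at h
    have hn := congrArg (fun z : ℂ => ‖z‖ ^ 2) h
    simp only [norm_mul, mul_pow, Pi.star_apply, norm_star, Complex.norm_real,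
      Real.norm_eq_abs, sq_abs] at hn
    rw [mul_comm, hn]
  have hsum : ‖c‖ ^ 2 * ∑ a ∈ Finset.univ.filter (fun a => |ρ a| ≤ γ),
      ‖α a (Sum.inr (Sum.inl ()))‖ ^ 2 ≤ γ ^ 2 * S := by
    calc _ ≤ γ ^ 2 * ∑ a ∈ Finset.univ.filter (fun a => |ρ a| ≤ γ),
          ‖star (α a) ⬝ᵥ Sum.elim ψT 0‖ ^ 2 := by
          rw [Finset.mul_sum, Finset.mul_sum]
          refine Finset.sum_le_sum fun a ha => ?_
          rw [hcomp]
          gcongr ?_ * _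
          exact sq_le_sq' (abs_le.1 (Finset.mem_filter.1 ha).2).1
            (abs_le.1 (Finset.mem_filter.1 ha).2).2
      _ ≤ γ ^ 2 * S := by
          gcongr
          refine (sum_norm_sq_star_dotProduct_le α (fun a b => ?_) _ _).trans_eq (by simp [S])
          rw [horth]
          congr
  rw [le_div_iff₀ hδ]
  refine le_of_mul_le_mul_left ?_ hc
  nlinarith [mul_le_mul_of_nonneg_left hsum hδ.le,
    mul_le_mul_of_nonneg_left hover (sq_nonneg γ), mul_nonneg (sq_nonneg γ) (mul_nonneg hδ.le hR),
    mul_nonneg (sq_nonneg γ) hc.le]
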